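/- (Local truncation error of the explicit SDG scheme.) Fix p ≥ 0 and a quadrature rule on [−1,1] with nodes −1 < s_0 < ⋯ < s_p = 1 and positive weights ω_i exact for degree 2p; let ℓ_i be the Lagrange basis, L_{ij} = ∫_{−1}^{1} ℓ_i′ ℓ_j dt − δ_{ip} δ_{jp}, assume L invertible with inverse entries l^{−1}_{ij}, and define the matrix L̃ by L̃_{0,j} = −l^{−1}_{0,j} and L̃_{m+1,j} = l^{−1}_{m,j} − l^{−1}_{m+1,j} for 0 ≤ m ≤ p−1. Let f be C^{2p+1} and globally Lipschitz in its second argument, u the exact solution of u′ = f(t,u) with u(t_n) = u_n, and for h > 0 set t_{n,m} = t_n + (h/2)(s_m + 1). Define iterates by explicit Euler initialization U^0_m = u_n + (t_{n,m} − t_n) f(t_n, u_n) and the explicit SDG update: U^{k+1}_0 = u_n + (h/2) ∑_{j=0}^{p} L̃_{0,j} ω_j f(t_{n,j}, U^k_j), and for 0 ≤ m ≤ p−1, U^{k+1}_{m+1} = U^{k+1}_m + (h/2) ω_m ( f(t_{n,m}, U^{k+1}_m) − f(t_{n,m}, U^k_m) ) + (h/2) ∑_{j=0}^{p} L̃_{m+1,j}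 ω_j f(t_{n,j}, U^k_j). Then for each fixed K ≥ 0 there exist C > 0 and h_0 > 0 such that for all 0 < h ≤ h_0: |u(t_{n,m}) − U^K_m| ≤ C h^{min(p+2, K+2)} for 0 ≤ m ≤ p−1, and |u(t_n + h) − U^K_p| ≤ C h^{min(2p+2, K+2)}. -/

import Mathlib

open Polynomial Filter Topology Asymptotics

theorem exists_polynomial_taylor_bound {g : ℝ → ℝ} {N : ℕ}
    (hg : ContDiff ℝ (N + 1) g) (a : ℝ) :
    ∃ S : ℝ[X], S.natDegree ≤ N ∧ ∃ C, ∀ τ ∈ Set.Icc (0 : ℝ) 1,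
      |g (a + τ) - S.eval τ| ≤ C * τ ^ (N + 1) := by
  obtain ⟨C, hC⟩ := exists_taylor_mean_remainder_bound (n := N) (f := g) (a := a) (b := a + 1)
    (by linarith) hg.contDiffOn
  refine ⟨∑ k ∈ Finset.range (N + 1), Polynomial.C
    ((k.factorial : ℝ)⁻¹ * iteratedDerivWithin k g (Set.Icc a (a + 1)) a) * X ^ k, ?_, C, ?_⟩
  · refine natDegree_sum_le_of_forall_le _ _ fun k hk => ?_
    exact (natDegree_C_mul_X_pow_le _ _).trans (Nat.lt_succ_iff.mp (Finset.mem_range.mp hk))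
  · intro τ hτ
    have h := hC (a + τ) ⟨by linarith [hτ.1], by linarith [hτ.2]⟩
    rw [taylor_within_apply] at h
    simp only [add_sub_cancel_left, smul_eq_mul, Real.norm_eq_abs] at h
    refine le_trans (le_of_eq ?_) h
    simp only [eval_finsetSum, eval_mul, eval_C, eval_pow, eval_X]
    congr 3 with k
    ring

theorem eventually_small : ∀ᶠ h in 𝓝[>] (0 : ℝ), 0 < h ∧ h ≤ 1 := by
  filter_upwards [Ioc_mem_nhdsGT (zero_lt_one' ℝ)] with h hh using hh

theorem pow_isBigO_pow {m n : ℕ} (hmn : m ≤ n) :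
    (fun h : ℝ => h ^ n) =O[𝓝[>] 0] fun h => h ^ m := by
  refine IsBigO.of_bound 1 ?_
  filter_upwards [eventually_small] with h hh
  rw [one_mul, Real.norm_eq_abs, Real.norm_eq_abs, abs_of_nonneg (by have := hh.1; positivity),
    abs_of_nonneg (by have := hh.1; positivity)]
  exact pow_le_pow_of_le_one hh.1.le hh.2 hmn

theorem isBigO_half_mul {g : ℝ → ℝ} {n : ℕ} (hg : g =O[𝓝[>] 0] fun h => h ^ n) :
    (fun h => h / 2 * g h) =O[𝓝[>] 0] fun h => h ^ (n + 1) := by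
  have h1 : (fun h : ℝ => h / 2) =O[𝓝[>] 0] fun h => h := by
    simpa [div_eq_inv_mul] using (isBigO_refl (fun h : ℝ => h) (𝓝[>] 0)).const_mul_left 2⁻¹
  simpa [pow_succ'] using h1.mul hg

theorem isBigO_mul_pow {f g : ℝ → ℝ} {m n k : ℕ} (hf : f =O[𝓝[>] 0] fun h => h ^ m)
    (hg : g =O[𝓝[>] 0] fun h => h ^ n) (hk : k ≤ m + n) :
    (fun h => f h * g h) =O[𝓝[>] 0] fun h => h ^ k := by
  have := hf.mul hg
  simp only [← pow_add] at this
  exact this.trans (pow_isBigO_pow hk)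

theorem scaled_offset_mem {x h : ℝ} (hx : x ∈ Set.Icc (-1 : ℝ) 1) (h0 : 0 < h) :
    h / 2 * (x + 1) ∈ Set.Icc 0 h :=
  ⟨mul_nonneg (by linarith) (by linarith [hx.1]), by nlinarith [hx.2]⟩

theorem quadrature_isBigO {ι : Type*} [Fintype ι] {b s : ι → ℝ} {σ : ℝ} {N : ℕ}
    (hs : ∀ j, s j ∈ Set.Icc (-1 : ℝ) 1) (hσ : σ ∈ Set.Icc (-1 : ℝ) 1)
    (hb : ∀ q : ℝ[X], q.natDegree ≤ N → ∑ j, b j * q.eval (s j) = ∫ x in (-1 : ℝ)..σ, q.eval x)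
    {φ g : ℝ → ℝ} (hφ : ∀ t, HasDerivAt φ (g t) t) (hg : ContDiff ℝ (N + 1) g) (a : ℝ) :
    (fun h => h / 2 * ∑ j, b j * g (a + h / 2 * (s j + 1))
      - (φ (a + h / 2 * (σ + 1)) - φ a)) =O[𝓝[>] 0] fun h => h ^ (N + 2) := by
  obtain ⟨S, hS, C, hC⟩ := exists_polynomial_taylor_bound hg a
  have hC0 : 0 ≤ C := by
    have := hC 1 (by simp)
    rw [one_pow, mul_one] at this
    exact (abs_nonneg _).trans this
  have key : ∀ h : ℝ, 0 < h → h ≤ 1 → ∀ x ∈ Set.Icc (-1 : ℝ) 1,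
      |g (a + h / 2 * (x + 1)) - S.eval (h / 2 * (x + 1))| ≤ C * h ^ (N + 1) := by
    intro h h0 h1 x hx
    have hm := scaled_offset_mem hx h0
    refine (hC _ ⟨hm.1, hm.2.trans h1⟩).trans ?_
    gcongr
    exacts [hm.1, hm.2]
  have hint : ∀ h : ℝ, h / 2 * ∫ x in (-1 : ℝ)..σ, g (a + h / 2 * (x + 1))
      = φ (a + h / 2 * (σ + 1)) - φ a := by
    intro h
    have hd : ∀ x ∈ Set.uIcc (-1 : ℝ) σ, HasDerivAt (fun x => φ (a + h / 2 * (x + 1)))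
        (h / 2 * g (a + h / 2 * (x + 1))) x := by
      intro x _
      have h1 : HasDerivAt (fun x : ℝ => a + h / 2 * (x + 1)) (h / 2) x := by
        simpa using (((hasDerivAt_id x).add_const 1).const_mul (h / 2)).const_add a
      exact ((hφ (a + h / 2 * (x + 1))).comp x h1).congr_deriv (mul_comm _ _)
    rw [← intervalIntegral.integral_const_mul, intervalIntegral.integral_eq_sub_of_hasDerivAt hd]
    · simp
    · have := hg.continuous
      exact Continuous.intervalIntegrable (by fun_prop) _ _
  have hSint : ∀ h : ℝ, ∑ j, b j * S.eval (h / 2 * (s j + 1))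
      = ∫ x in (-1 : ℝ)..σ, S.eval (h / 2 * (x + 1)) := by
    intro h
    have := hb (S.comp (Polynomial.C (h / 2) * (X + 1))) ?_
    · simpa using this
    · refine natDegree_comp_le.trans ?_
      have h1 : (Polynomial.C (h / 2) * (X + 1)).natDegree ≤ 1 := by compute_degree
      nlinarith
  refine IsBigO.of_bound (1 / 2 * (∑ j, |b j| * C + C * |σ - -1|)) ?_
  filter_upwards [eventually_small] with h ⟨h0, h1⟩
  have hc := hg.continuous
  have hI : |∫ x in (-1 : ℝ)..σ, (g (a + h / 2 * (x + 1)) - S.eval (h / 2 * (x + 1)))|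
      ≤ C * h ^ (N + 1) * |σ - -1| := by
    rw [← Real.norm_eq_abs]
    refine intervalIntegral.norm_integral_le_of_norm_le_const fun x hx => ?_
    rw [Set.uIoc_of_le hσ.1] at hx
    exact key h h0 h1 x ⟨hx.1.le, hx.2.trans hσ.2⟩
  rw [intervalIntegral.integral_sub (Continuous.intervalIntegrable (by fun_prop) _ _)
    (Continuous.intervalIntegrable (by fun_prop) _ _), ← hSint] at hI
  have hsum : |∑ j, b j * (g (a + h / 2 * (s j + 1)) - S.eval (h / 2 * (s j + 1)))|
      ≤ (∑ j, |b j| * C) * h ^ (N + 1) := by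
    refine (Finset.abs_sum_le_sum_abs _ _).trans ?_
    rw [Finset.sum_mul]
    refine Finset.sum_le_sum fun j _ => ?_
    rw [abs_mul, mul_assoc]
    exact mul_le_mul_of_nonneg_left (key h h0 h1 _ (hs j)) (abs_nonneg _)
  rw [← hint h, ← mul_sub, norm_mul, Real.norm_eq_abs, Real.norm_eq_abs, Real.norm_eq_abs,
    abs_of_pos (half_pos h0), abs_of_pos (pow_pos h0 _)]
  have hsplit : ∑ j, b j * g (a + h / 2 * (s j + 1))
      - ∫ x in (-1 : ℝ)..σ, g (a + h / 2 * (x + 1))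
      = ∑ j, b j * (g (a + h / 2 * (s j + 1)) - S.eval (h / 2 * (s j + 1)))
        - ((∫ x in (-1 : ℝ)..σ, g (a + h / 2 * (x + 1)))
          - ∑ j, b j * S.eval (h / 2 * (s j + 1))) := by
    simp only [mul_sub, Finset.sum_sub_distrib]
    ring
  rw [hsplit]
  refine (mul_le_mul_of_nonneg_left ((abs_sub _ _).trans (add_le_add hsum hI))
    (half_pos h0).le).trans (le_of_eq ?_)
  ring

theorem exists_polynomial_approx_ode (P : ℝ[X]) (n : ℕ) :
    ∃ V : ℝ[X], V.natDegree ≤ n ∧ V.eval 0 = 1 ∧ X ^ n ∣ derivative V + P * V := by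
  induction n with
  | zero => exact ⟨1, by simp, by simp, by simp⟩
  | succ n ih =>
    obtain ⟨V, hd, h0, R, hR⟩ := ih
    set c := R.eval 0 / (n + 1) with hc
    refine ⟨V - C c * X ^ (n + 1), ?_, by simp [h0], ?_⟩
    · refine (natDegree_sub_le _ _).trans (max_le (by omega) (natDegree_C_mul_X_pow_le _ _))
    · have hX : X ∣ R - C (R.eval 0) := by
        have := X_sub_C_dvd_sub_C_eval (a := (0 : ℝ)) (p := R)
        simpa using this
      obtain ⟨T, hT⟩ := hX
      refine ⟨T - P * C c, ?_⟩
      have hcc : C c * ((n : ℝ[X]) + 1) = C (R.eval 0) := by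
        rw [hc, show ((n : ℝ[X]) + 1) = C ((n : ℝ) + 1) by simp, ← C_mul]
        congr 1
        field_simp
      have : derivative (V - C c * X ^ (n + 1)) + P * (V - C c * X ^ (n + 1))
          = (derivative V + P * V) - (C c * ((n : ℝ[X]) + 1)) * X ^ n
            - P * (C c * X ^ (n + 1)) := by
        simp
        ring
      rw [this, hR, hcc, mul_comm (C _), ← mul_sub, hT]
      ring

theorem integral_eval_derivative (q : ℝ[X]) (a b : ℝ) :
    ∫ x in a..b, (derivative q).eval x = q.eval b - q.eval a :=
  intervalIntegral.integral_eq_sub_of_hasDerivAt (fun x _ => q.hasDerivAt x)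
    ((derivative q).continuous.intervalIntegrable _ _)

theorem exists_antiderivative (q : ℝ[X]) :
    ∃ Q : ℝ[X], Q.natDegree ≤ q.natDegree + 1 ∧ derivative Q = q ∧ Q.eval (-1) = 0 := by
  let R : ℝ[X] := ∑ k ∈ Finset.range (q.natDegree + 1), C (q.coeff k / (k + 1)) * X ^ (k + 1)
  have hR : R.natDegree ≤ q.natDegree + 1 := natDegree_sum_le_of_forall_le _ _ fun k hk =>
    (natDegree_C_mul_X_pow_le _ _).trans (by have := Finset.mem_range.mp hk; omega)
  refine ⟨R - C (R.eval (-1)), natDegree_sub_C.le.trans hR, ?_, by simp⟩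
  conv_rhs => rw [q.as_sum_range_C_mul_X_pow]
  simp only [R, derivative_sub, derivative_C, sub_zero, derivative_sum]
  refine Finset.sum_congr rfl fun k _ => ?_
  rw [derivative_C_mul_X_pow]
  congr 2
  push_cast
  field_simp

section Radau

variable {p : ℕ} {s ω : Fin (p + 1) → ℝ} {ℓ : Fin (p + 1) → ℝ[X]}
  {L : Matrix (Fin (p + 1)) (Fin (p + 1)) ℝ}

theorem eq_sum_lagrange (hs : StrictMono s) (hdeg : ∀ i, (ℓ i).natDegree ≤ p)
    (hval : ∀ i j, (ℓ i).eval (s j) = if i = j then 1 else 0) {v : ℝ[X]} (hv : v.natDegree ≤ p) :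
    v = ∑ i, C (v.eval (s i)) * ℓ i := by
  have hlt : ∀ {q : ℝ[X]}, q.natDegree ≤ p → q.degree < (Finset.univ : Finset (Fin (p + 1))).card :=
    fun {q} hq => by
      rw [Finset.card_univ, Fintype.card_fin]
      exact (degree_le_natDegree).trans_lt (by exact_mod_cast Nat.lt_succ_of_le hq)
  refine eq_of_degrees_lt_of_eval_index_eq Finset.univ (v := s) hs.injective.injOn (hlt hv)
    (hlt (natDegree_sum_le_of_forall_le _ _ fun i _ => ?_)) fun j _ => ?_
  · exact (natDegree_C_mul_le _ _).trans (hdeg i)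
  · simp [eval_finsetSum, hval]

theorem quadrature_derivative
    (hexact : ∀ q : ℝ[X], q.natDegree ≤ 2 * p →
      ∑ i, ω i * q.eval (s i) = ∫ x in (-1:ℝ)..1, q.eval x)
    {q : ℝ[X]} (hq : q.natDegree ≤ 2 * p + 1) :
    ∑ i, ω i * (derivative q).eval (s i) = q.eval 1 - q.eval (-1) := by
  rw [hexact _ ((natDegree_derivative_le q).trans (by omega)), integral_eval_derivative]

theorem dgMatrix_eq
    (hexact : ∀ q : ℝ[X], q.natDegree ≤ 2 * p →
      ∑ i, ω i * q.eval (s i) = ∫ x in (-1:ℝ)..1, q.eval x)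
    (hdeg : ∀ i, (ℓ i).natDegree ≤ p)
    (hval : ∀ i j, (ℓ i).eval (s j) = if i = j then 1 else 0)
    (hLdef : ∀ i j, L i j = (∫ x in (-1:ℝ)..1, (derivative (ℓ i)).eval x * (ℓ j).eval x)
        - (if i = Fin.last p then (1:ℝ) else 0) * (if j = Fin.last p then (1:ℝ) else 0))
    (i j : Fin (p + 1)) :
    L i j = ω j * (derivative (ℓ i)).eval (s j)
      - (if i = Fin.last p then (1:ℝ) else 0) * (if j = Fin.last p then (1:ℝ) else 0) := by
  rw [hLdef]
  congr 1
  have h := hexact (derivative (ℓ i) * ℓ j) ?_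
  · simp only [eval_mul] at h
    rw [← h]
    simp [hval]
  · have := natDegree_derivative_le (ℓ i)
    have := hdeg i
    have := hdeg j
    exact natDegree_mul_le.trans (by omega)

theorem sum_eval_mul_dgMatrix (hs : StrictMono s) (hsp : s (Fin.last p) = 1)
    (hdeg : ∀ i, (ℓ i).natDegree ≤ p)
    (hval : ∀ i j, (ℓ i).eval (s j) = if i = j then 1 else 0)
    (hL : ∀ i j, L i j = ω j * (derivative (ℓ i)).eval (s j)
      - (if i = Fin.last p then (1:ℝ) else 0) * (if j = Fin.last p then (1:ℝ) else 0))
    {v : ℝ[X]} (hv : v.natDegree ≤ p) (j : Fin (p + 1)) :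
    ∑ i, v.eval (s i) * L i j
      = ω j * (derivative v).eval (s j) - if j = Fin.last p then v.eval 1 else 0 := by
  have hd : (derivative v).eval (s j) = ∑ i, v.eval (s i) * (derivative (ℓ i)).eval (s j) := by
    conv_lhs => rw [eq_sum_lagrange hs hdeg hval hv]
    simp [eval_finsetSum]
  simp only [hL, mul_sub, Finset.sum_sub_distrib, hd, Finset.mul_sum]
  congr 1
  · exact Finset.sum_congr rfl fun i _ => by ring
  · split_ifs <;> simp [*]

theorem collocation_exact (hsp : s (Fin.last p) = 1)
    (hexact : ∀ q : ℝ[X], q.natDegree ≤ 2 * p →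
      ∑ i, ω i * q.eval (s i) = ∫ x in (-1:ℝ)..1, q.eval x)
    (hdeg : ∀ i, (ℓ i).natDegree ≤ p)
    (hval : ∀ i j, (ℓ i).eval (s j) = if i = j then 1 else 0)
    (hL : ∀ i j, L i j = ω j * (derivative (ℓ i)).eval (s j)
      - (if i = Fin.last p then (1:ℝ) else 0) * (if j = Fin.last p then (1:ℝ) else 0))
    (hLinv : IsUnit L.det) (m : Fin (p + 1)) {q : ℝ[X]} (hq : q.natDegree ≤ p) :
    ∑ j, -(L⁻¹ m j) * ω j * q.eval (s j) = ∫ x in (-1:ℝ)..s m, q.eval x := by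
  obtain ⟨Q, hQd, rfl, hQ0⟩ := exists_antiderivative q
  have hmul : L.mulVec (fun j => Q.eval (s j)) = fun i => -(ω i * (derivative Q).eval (s i)) := by
    funext i
    have h := quadrature_derivative hexact (q := ℓ i * Q)
      (natDegree_mul_le.trans (by have := hdeg i; omega))
    simp only [derivative_mul, eval_add, eval_mul, mul_add, Finset.sum_add_distrib, hQ0, mul_zero,
      sub_zero] at h
    have h1 : ∑ j, ω j * ((ℓ i).eval (s j) * (derivative Q).eval (s j))
        = ω i * (derivative Q).eval (s i) := by simp [hval]
    have h2 : (ℓ i).eval 1 = if i = Fin.last p then 1 else 0 := by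
      rw [← hval i (Fin.last p), hsp]
    rw [h1, h2] at h
    simp only [Matrix.mulVec, dotProduct, hL, sub_mul, Finset.sum_sub_distrib]
    have h3 : ∑ j, (if i = Fin.last p then (1:ℝ) else 0) * (if j = Fin.last p then (1:ℝ) else 0)
        * Q.eval (s j) = (if i = Fin.last p then (1:ℝ) else 0) * Q.eval 1 := by
      simp [hsp]
    rw [h3, ← h]
    simp only [mul_assoc]
    ring
  have hinv : L⁻¹.mulVec (L.mulVec fun j => Q.eval (s j)) = fun j => Q.eval (s j) := by
    rw [Matrix.mulVec_mulVec, Matrix.nonsing_inv_mul _ hLinv, Matrix.one_mulVec]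
  rw [integral_eval_derivative, hQ0, sub_zero]
  have := congrFun hinv m
  rw [hmul] at this
  simp only [Matrix.mulVec, dotProduct] at this
  rw [← this]
  exact Finset.sum_congr rfl fun j _ => by ring

/-- The weak form of a Runge-Kutta relation with coefficient matrix `-L⁻¹ diag ω`. -/
theorem weak_form_residual (hs : StrictMono s) (hsp : s (Fin.last p) = 1)
    (hexact : ∀ q : ℝ[X], q.natDegree ≤ 2 * p →
      ∑ i, ω i * q.eval (s i) = ∫ x in (-1:ℝ)..1, q.eval x)
    (hdeg : ∀ i, (ℓ i).natDegree ≤ p)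
    (hval : ∀ i j, (ℓ i).eval (s j) = if i = j then 1 else 0)
    (hL : ∀ i j, L i j = ω j * (derivative (ℓ i)).eval (s j)
      - (if i = Fin.last p then (1:ℝ) else 0) * (if j = Fin.last p then (1:ℝ) else 0))
    (hLinv : IsUnit L.det) {v : ℝ[X]} (hv : v.natDegree ≤ p) (c y₀ : ℝ) (y F : Fin (p + 1) → ℝ) :
    ∑ j, ω j * (derivative v).eval (s j) * y j + c * ∑ j, ω j * v.eval (s j) * F j
        - v.eval 1 * y (Fin.last p) + v.eval (-1) * y₀
      = ∑ j, (ω j * (derivative v).eval (s j) - if j = Fin.last p then v.eval 1 else 0)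
          * (y j - y₀ - c * ∑ i, -(L⁻¹ j i) * ω i * F i) := by
  set w : Fin (p + 1) → ℝ := fun i => v.eval (s i) with hw
  have hvec : ∀ j, ω j * (derivative v).eval (s j) - (if j = Fin.last p then v.eval 1 else 0)
      = Matrix.vecMul w L j := fun j => by
    rw [← sum_eval_mul_dgMatrix hs hsp hdeg hval hL hv]; rfl
  have h1 : ∑ j, Matrix.vecMul w L j * ∑ i, -(L⁻¹ j i) * ω i * F i = -∑ j, ω j * w j * F j := by
    have h2 : dotProduct (Matrix.vecMul w L) (L⁻¹.mulVec fun i => ω i * F i)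
        = dotProduct w fun i => ω i * F i := by
      rw [← Matrix.dotProduct_mulVec, Matrix.mulVec_mulVec, Matrix.mul_nonsing_inv _ hLinv,
        Matrix.one_mulVec]
    simp only [dotProduct, Matrix.mulVec] at h2
    rw [← Finset.sum_neg_distrib, ← neg_inj, ← Finset.sum_neg_distrib, ← Finset.sum_neg_distrib]
    calc _ = ∑ j, Matrix.vecMul w L j * ∑ i, L⁻¹ j i * (ω i * F i) := by
          refine Finset.sum_congr rfl fun j _ => ?_
          rw [← mul_neg, ← Finset.sum_neg_distrib]
          congr 1
          exact Finset.sum_congr rfl fun i _ => by ring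
      _ = _ := h2
      _ = _ := Finset.sum_congr rfl fun j _ => by ring
  have h0 := quadrature_derivative hexact (q := v) (by omega)
  have h3 : ∑ j, Matrix.vecMul w L j * (y j - y₀ - c * ∑ i, -(L⁻¹ j i) * ω i * F i)
      = ∑ j, Matrix.vecMul w L j * y j - (∑ j, Matrix.vecMul w L j) * y₀
        - c * ∑ j, Matrix.vecMul w L j * ∑ i, -(L⁻¹ j i) * ω i * F i := by
    simp only [mul_sub, Finset.sum_sub_distrib, Finset.sum_mul, Finset.mul_sum]
    congr 1
    exact Finset.sum_congr rfl fun j _ => Finset.sum_congr rfl fun i _ => by ring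
  simp only [hvec]
  rw [h3, h1]
  simp only [← hvec, sub_mul, Finset.sum_sub_distrib, h0]
  simp
  ring

end Radau

theorem sdg_update_eq {p : ℕ} {ω : Fin (p + 1) → ℝ} {Ltil M : Matrix (Fin (p + 1)) (Fin (p + 1)) ℝ}
    (hLtil0 : ∀ j, Ltil 0 j = -(M 0 j))
    (hLtilS : ∀ (m : Fin p) (j : Fin (p + 1)), Ltil m.succ j = M m.castSucc j - M m.succ j)
    {c y₀ : ℝ} {y F G : Fin (p + 1) → ℝ} (h0 : y 0 = y₀ + c * ∑ j, Ltil 0 j * ω j * F j)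
    (hS : ∀ m : Fin p, y m.succ = y m.castSucc + c * ω m.castSucc * (G m.castSucc - F m.castSucc)
      + c * ∑ j, Ltil m.succ j * ω j * F j) (m : Fin (p + 1)) :
    y m = y₀ + c * ∑ j, -(M m j) * ω j * F j + c * ∑ i ∈ Finset.Iio m, ω i * (G i - F i) := by
  induction m using Fin.induction with
  | zero => simp [h0, hLtil0, show Finset.Iio (0 : Fin (p + 1)) = ∅ by ext; simp]
  | succ m ih =>
    have hI : Finset.Iio m.succ = insert m.castSucc (Finset.Iio m.castSucc) := by
      ext i
      simp only [Finset.mem_Iio, Finset.mem_insert, Fin.lt_def, Fin.ext_iff, Fin.val_succ,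
        Fin.val_castSucc]
      omega
    have hsum : ∑ j, Ltil m.succ j * ω j * F j
        = ∑ j, -(M m.succ j) * ω j * F j - ∑ j, -(M m.castSucc j) * ω j * F j := by
      rw [← Finset.sum_sub_distrib]
      exact Finset.sum_congr rfl fun j _ => by rw [hLtilS]; ring
    rw [hS, ih, hsum, hI, Finset.sum_insert (by simp)]
    ring

theorem isBigO_of_lower_recursion {p r : ℕ} {ω : Fin (p + 1) → ℝ} {X R Y : Fin (p + 1) → ℝ → ℝ}
    (hX : ∀ m h, X m h = R m h + h / 2 * ∑ i ∈ Finset.Iio m, ω i * Y i h)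
    (hR : ∀ m, R m =O[𝓝[>] 0] fun h => h ^ r)
    (hY : ∀ i, X i =O[𝓝[>] 0] (fun h => h ^ r) → Y i =O[𝓝[>] 0] fun h => h ^ r)
    (m : Fin (p + 1)) : X m =O[𝓝[>] 0] fun h => h ^ r := by
  induction m using WellFoundedLT.induction with
  | ind m ih =>
    have hsum : (fun h => ∑ i ∈ Finset.Iio m, ω i * Y i h) =O[𝓝[>] 0] fun h => h ^ r :=
      IsBigO.fun_sum fun i hi => (hY i (ih i (Finset.mem_Iio.mp hi))).const_mul_left _
    exact ((hR m).add ((isBigO_half_mul hsum).trans (pow_isBigO_pow r.le_succ))).congr_left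
      fun h => (hX m h).symm

theorem LipschitzWith.isBigO_sub_comp {α : Type*} {l : Filter α} {f : ℝ → ℝ → ℝ} {Λ : NNReal}
    (hLip : ∀ t, LipschitzWith Λ (f t)) (t y z : α → ℝ) :
    (fun a => f (t a) (y a) - f (t a) (z a)) =O[l] fun a => y a - z a :=
  IsBigO.of_bound Λ (Eventually.of_forall fun a => (hLip (t a)).norm_sub_le _ _)

theorem scaled_offset_isBigO (x : ℝ) :
    (fun h : ℝ => h / 2 * (x + 1)) =O[𝓝[>] 0] fun h => h ^ 1 := by
  have := isBigO_half_mul (n := 0) (g := fun _ => x + 1)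
    (by simpa using isBigO_const_one ℝ (x + 1) (𝓝[>] (0 : ℝ)))
  simpa using this

theorem tendsto_scaled_offset (x : ℝ) :
    Tendsto (fun h : ℝ => h / 2 * (x + 1)) (𝓝[>] 0) (𝓝 0) := by
  have : Continuous fun h : ℝ => h / 2 * (x + 1) := by fun_prop
  simpa using (this.tendsto 0).mono_left nhdsWithin_le_nhds

theorem isBigO_one_comp_scaled_offset {g : ℝ → ℝ} (hg : Continuous g) (x : ℝ) :
    (fun h : ℝ => g (h / 2 * (x + 1))) =O[𝓝[>] 0] fun h => h ^ 0 := by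
  simpa using ((hg.tendsto 0).comp (tendsto_scaled_offset x)).isBigO_one ℝ

theorem isBigO_taylor_linearization {α : Type*} {l : Filter α} {f : ℝ → ℝ → ℝ}
    (hf : ContDiff ℝ 2 (Function.uncurry f)) {t y z : α → ℝ} {t₀ y₀ : ℝ}
    (ht : Tendsto t l (𝓝 t₀)) (hy : Tendsto y l (𝓝 y₀)) (hz : Tendsto z l (𝓝 y₀)) :
    (fun a => f (t a) (y a) - f (t a) (z a)
      - fderiv ℝ (Function.uncurry f) (t a, z a) (0, 1) * (y a - z a))
        =O[l] fun a => (y a - z a) ^ 2 := by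
  set F : ℝ × ℝ → ℝ := fun x => fderiv ℝ (Function.uncurry f) x (0, 1) with hF
  have hFc : ContDiff ℝ 1 F :=
    (hf.fderiv_right (m := 1) (by norm_num)).clm_apply contDiff_const
  obtain ⟨K, S, hS, hK⟩ := hFc.contDiffAt.exists_lipschitzOnWith (x := (t₀, y₀))
  obtain ⟨ε, hε, hball⟩ := Metric.mem_nhds_iff.mp hS
  refine IsBigO.of_bound K ?_
  filter_upwards [ht (Metric.ball_mem_nhds _ hε), hy (Metric.ball_mem_nhds _ hε),
    hz (Metric.ball_mem_nhds _ hε)] with a hta hya hza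
  have hseg : ∀ w ∈ Set.uIcc (z a) (y a), (t a, w) ∈ S := fun w hw => by
    refine hball ?_
    rw [← ball_prod_same]
    refine ⟨hta, ?_⟩
    have := (convex_ball y₀ ε).segment_subset hza hya
    rw [segment_eq_uIcc] at this
    exact this hw
  have hder : ∀ w, HasDerivAt (f (t a)) (F (t a, w)) w := fun w => by
    have h1 := (hf.differentiable (by norm_num) (t a, w)).hasFDerivAt
    exact h1.comp_hasDerivAt w ((hasDerivAt_const w (t a)).prodMk (hasDerivAt_id w))
  have hmv := (convex_uIcc (z a) (y a)).norm_image_sub_le_of_norm_hasDerivWithin_le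
    (f := fun w => f (t a) w - F (t a, z a) * w) (f' := fun w => F (t a, w) - F (t a, z a))
    (C := K * |y a - z a|)
    (fun w _ => by
      exact ((hder w).sub (((hasDerivAt_id w).const_mul (F (t a, z a))).congr_deriv
        (mul_one _))).hasDerivWithinAt)
    (fun w hw => by
      refine (hK.norm_sub_le (hseg w hw) (hseg _ Set.left_mem_uIcc)).trans ?_
      refine mul_le_mul_of_nonneg_left ?_ K.2
      simpa [Prod.norm_def] using Set.abs_sub_left_of_mem_uIcc hw)
    Set.left_mem_uIcc Set.right_mem_uIcc
  calc _ = ‖f (t a) (y a) - F (t a, z a) * y a - (f (t a) (z a) - F (t a, z a) * z a)‖ := by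
        congr 1; ring
    _ ≤ _ := hmv
    _ = _ := by
        rw [norm_pow, Real.norm_eq_abs]; ring

theorem contDiff_of_ode {f : ℝ → ℝ → ℝ} {u : ℝ → ℝ} {n : ℕ}
    (hf : ContDiff ℝ n (Function.uncurry f)) (hu : ∀ t, HasDerivAt u (f t (u t)) t) :
    ContDiff ℝ n u ∧ ContDiff ℝ n fun t => f t (u t) := by
  have hderiv : deriv u = fun t => f t (u t) := funext fun t => (hu t).deriv
  have key : ∀ m ≤ n, ContDiff ℝ m u := by
    intro m
    induction m with
    | zero =>
      intro _
      simpa using (continuous_iff_continuousAt.mpr fun t => (hu t).continuousAt)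
    | succ m ih =>
      intro hm
      push_cast
      refine contDiff_succ_iff_deriv.mpr ⟨fun t => (hu t).differentiableAt, by simp, ?_⟩
      rw [hderiv]
      exact (hf.of_le (by exact_mod_cast (Nat.le_succ m).trans hm)).comp
        (contDiff_id.prodMk (ih ((Nat.le_succ m).trans hm)))
  exact ⟨key n le_rfl, hf.comp (contDiff_id.prodMk (key n le_rfl))⟩

section Iterates

variable {p : ℕ} {s ω : Fin (p + 1) → ℝ} {A : Fin (p + 1) → Fin (p + 1) → ℝ} {f : ℝ → ℝ → ℝ}
  {Λ : NNReal} {u : ℝ → ℝ} {tn un : ℝ} {U : ℝ → ℕ → Fin (p + 1) → ℝ}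

theorem iterate_succ_sub_isBigO (hf : Differentiable ℝ (Function.uncurry f))
    (hLip : ∀ t, LipschitzWith Λ (f t)) (hA : ∀ m, ∑ j, A m j = s m + 1)
    (hU0 : ∀ h m, U h 0 m = un + (h / 2 * (s m + 1)) * f tn un)
    (hU : ∀ h k m, U h (k + 1) m = un + h / 2 * ∑ j, A m j * f (tn + h / 2 * (s j + 1)) (U h k j)
      + h / 2 * ∑ i ∈ Finset.Iio m, ω i * (f (tn + h / 2 * (s i + 1)) (U h (k + 1) i)
        - f (tn + h / 2 * (s i + 1)) (U h k i))) (k : ℕ) (m : Fin (p + 1)) :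
    (fun h => U h (k + 1) m - U h k m) =O[𝓝[>] 0] fun h => h ^ (k + 2) := by
  induction k generalizing m with
  | zero =>
    refine isBigO_of_lower_recursion (ω := ω)
      (R := fun m h => h / 2 * ∑ j, A m j * (f (tn + h / 2 * (s j + 1)) (U h 0 j) - f tn un))
      (X := fun m h => U h (0 + 1) m - U h 0 m)
      (Y := fun i h => f (tn + h / 2 * (s i + 1)) (U h (0 + 1) i)
        - f (tn + h / 2 * (s i + 1)) (U h 0 i))
      (fun m h => ?_) (fun m => ?_)
      (fun i hi => (LipschitzWith.isBigO_sub_comp hLip _ _ _).trans hi) m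
    · simp only [mul_sub, Finset.sum_sub_distrib, ← Finset.sum_mul, hA]
      rw [hU, hU0 h m]
      simp only [mul_sub, Finset.sum_sub_distrib]
      ring
    · refine isBigO_half_mul (IsBigO.fun_sum fun j _ => IsBigO.const_mul_left ?_ _)
      have hy : (fun h => (h / 2 * (s j + 1)) * f tn un) =O[𝓝[>] 0] fun h => h ^ 1 := by
        simpa [mul_comm] using (scaled_offset_isBigO (s j)).const_mul_left (f tn un)
      have ht := tendsto_scaled_offset (s j)
      have hlim : Tendsto (fun h => ((tn + h / 2 * (s j + 1), U h 0 j) : ℝ × ℝ)) (𝓝[>] 0)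
          (𝓝 (tn, un)) := by
        simp only [hU0]
        refine Tendsto.prodMk_nhds ?_ ?_
        · simpa using ht.const_add tn
        · simpa using (ht.mul_const (f tn un)).const_add un
      refine ((hf (tn, un)).isBigO_sub.comp_tendsto hlim).trans ?_
      refine IsBigO.congr_left ((scaled_offset_isBigO (s j)).prod_left hy) fun h => ?_
      simp [hU0]
  | succ k ih =>
    have hF : ∀ j, (fun h => f (tn + h / 2 * (s j + 1)) (U h (k + 1) j)
        - f (tn + h / 2 * (s j + 1)) (U h k j)) =O[𝓝[>] 0] fun h => h ^ (k + 2) := fun j =>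
      (LipschitzWith.isBigO_sub_comp hLip _ _ _).trans (ih j)
    refine isBigO_of_lower_recursion (ω := ω)
      (R := fun m h => h / 2 * (∑ j, A m j * (f (tn + h / 2 * (s j + 1)) (U h (k + 1) j)
          - f (tn + h / 2 * (s j + 1)) (U h k j))
        - ∑ i ∈ Finset.Iio m, ω i * (f (tn + h / 2 * (s i + 1)) (U h (k + 1) i)
          - f (tn + h / 2 * (s i + 1)) (U h k i))))
      (X := fun m h => U h (k + 1 + 1) m - U h (k + 1) m)
      (Y := fun i h => f (tn + h / 2 * (s i + 1)) (U h (k + 1 + 1) i)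
        - f (tn + h / 2 * (s i + 1)) (U h (k + 1) i))
      (fun m h => ?_) (fun m => ?_)
      (fun i hi => (LipschitzWith.isBigO_sub_comp hLip _ _ _).trans hi) m
    · rw [hU h (k + 1) m, hU h k m]
      simp only [mul_sub, Finset.sum_sub_distrib]
      ring
    · exact isBigO_half_mul ((IsBigO.fun_sum fun j _ => (hF j).const_mul_left _).sub
        (IsBigO.fun_sum fun j _ => (hF j).const_mul_left _))

theorem iterate_residual_isBigO (hLip : ∀ t, LipschitzWith Λ (f t))
    (hU : ∀ h k m, U h (k + 1) m = un + h / 2 * ∑ j, A m j * f (tn + h / 2 * (s j + 1)) (U h k j)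
      + h / 2 * ∑ i ∈ Finset.Iio m, ω i * (f (tn + h / 2 * (s i + 1)) (U h (k + 1) i)
        - f (tn + h / 2 * (s i + 1)) (U h k i)))
    (hdiff : ∀ k m, (fun h => U h (k + 1) m - U h k m) =O[𝓝[>] 0] fun h => h ^ (k + 2))
    (k : ℕ) (m : Fin (p + 1)) :
    (fun h => U h k m - un - h / 2 * ∑ j, A m j * f (tn + h / 2 * (s j + 1)) (U h k j))
      =O[𝓝[>] 0] fun h => h ^ (k + 2) := by
  have hF : (fun h => ∑ i ∈ Finset.Iio m, ω i * (f (tn + h / 2 * (s i + 1)) (U h (k + 1) i)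
      - f (tn + h / 2 * (s i + 1)) (U h k i))) =O[𝓝[>] 0] fun h => h ^ (k + 2) :=
    IsBigO.fun_sum fun j _ =>
      ((LipschitzWith.isBigO_sub_comp hLip _ _ _).trans (hdiff k j)).const_mul_left _
  refine (((isBigO_half_mul hF).trans (pow_isBigO_pow (Nat.le_succ _))).sub (hdiff k m)).congr_left
    fun h => ?_
  rw [hU h k m]
  ring

theorem iterate_error_isBigO (hLip : ∀ t, LipschitzWith Λ (f t))
    (hU0 : ∀ h m, U h 0 m = un + (h / 2 * (s m + 1)) * f tn un)
    (hU : ∀ h k m, U h (k + 1) m = un + h / 2 * ∑ j, A m j * f (tn + h / 2 * (s j + 1)) (U h k j)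
      + h / 2 * ∑ i ∈ Finset.Iio m, ω i * (f (tn + h / 2 * (s i + 1)) (U h (k + 1) i)
        - f (tn + h / 2 * (s i + 1)) (U h k i)))
    (hdiff : ∀ k m, (fun h => U h (k + 1) m - U h k m) =O[𝓝[>] 0] fun h => h ^ (k + 2))
    (heuler : ∀ m, (fun h => h / 2 * ((s m + 1) * f tn un) - (u (tn + h / 2 * (s m + 1)) - un))
      =O[𝓝[>] 0] fun h => h ^ 2)
    (hquad : ∀ m, (fun h => h / 2 * ∑ j, A m j * f (tn + h / 2 * (s j + 1))
        (u (tn + h / 2 * (s j + 1))) - (u (tn + h / 2 * (s m + 1)) - un))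
      =O[𝓝[>] 0] fun h => h ^ (p + 2)) (k : ℕ) (m : Fin (p + 1)) :
    (fun h => U h k m - u (tn + h / 2 * (s m + 1)))
      =O[𝓝[>] 0] fun h => h ^ (min (p + 2) (k + 2)) := by
  induction k generalizing m with
  | zero =>
    refine ((heuler m).congr_left fun h => ?_).trans (pow_isBigO_pow (min_le_right _ _))
    rw [hU0]
    ring
  | succ k ih =>
    have hF : (fun h => ∑ i ∈ Finset.Iio m, ω i * (f (tn + h / 2 * (s i + 1)) (U h (k + 1) i)
        - f (tn + h / 2 * (s i + 1)) (U h k i))) =O[𝓝[>] 0] fun h => h ^ (k + 2) :=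
      IsBigO.fun_sum fun j _ =>
        ((LipschitzWith.isBigO_sub_comp hLip _ _ _).trans (hdiff k j)).const_mul_left _
    have hE : (fun h => ∑ j, A m j * (f (tn + h / 2 * (s j + 1)) (U h k j)
        - f (tn + h / 2 * (s j + 1)) (u (tn + h / 2 * (s j + 1)))))
        =O[𝓝[>] 0] fun h => h ^ (min (p + 2) (k + 2)) :=
      IsBigO.fun_sum fun j _ =>
        ((LipschitzWith.isBigO_sub_comp hLip _ _ _).trans (ih j)).const_mul_left _
    refine ((((hquad m).trans (pow_isBigO_pow (min_le_left _ _))).add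
      ((isBigO_half_mul hF).trans (pow_isBigO_pow (min_le_right _ _)))).add
      ((isBigO_half_mul hE).trans (pow_isBigO_pow (by omega)))).congr_left fun h => ?_
    rw [hU h k m]
    simp only [mul_sub, Finset.sum_sub_distrib]
    ring

end Iterates

theorem exists_polynomial_adjoint_approx {a : ℝ → ℝ} {q : ℕ} (ha : ContDiff ℝ (q + 1) a) (tn : ℝ) :
    ∃ V : ℝ[X], V.natDegree ≤ q + 1 ∧ V.eval 0 = 1 ∧ ∀ x ∈ Set.Icc (-1 : ℝ) 1,
      (fun h => (derivative V).eval (h / 2 * (x + 1))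
        + a (tn + h / 2 * (x + 1)) * V.eval (h / 2 * (x + 1)))
        =O[𝓝[>] 0] fun h => h ^ (q + 1) := by
  obtain ⟨P, -, C, hC⟩ := exists_polynomial_taylor_bound ha tn
  obtain ⟨V, hV, hV0, R, hR⟩ := exists_polynomial_approx_ode P (q + 1)
  refine ⟨V, hV, hV0, fun x hx => ?_⟩
  have hpow : (fun h : ℝ => (h / 2 * (x + 1)) ^ (q + 1)) =O[𝓝[>] 0] fun h => h ^ (q + 1) := by
    simpa using (scaled_offset_isBigO x).pow (q + 1)
  have h1 : (fun h : ℝ => a (tn + h / 2 * (x + 1)) - P.eval (h / 2 * (x + 1)))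
      =O[𝓝[>] 0] fun h => h ^ (q + 1) := by
    refine IsBigO.trans (IsBigO.of_bound C ?_) hpow
    filter_upwards [eventually_small] with h ⟨h0, h1⟩
    have hm := scaled_offset_mem hx h0
    rw [norm_pow, Real.norm_eq_abs, Real.norm_eq_abs, abs_of_nonneg hm.1]
    exact hC _ ⟨hm.1, hm.2.trans h1⟩
  have h2 := isBigO_mul_pow hpow (isBigO_one_comp_scaled_offset R.continuous x) le_rfl
  have h3 := isBigO_mul_pow h1 (isBigO_one_comp_scaled_offset V.continuous x) le_rfl
  refine (h2.add h3).congr_left fun h => ?_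
  have := congrArg (eval (h / 2 * (x + 1))) hR
  simp only [eval_add, eval_mul, eval_pow, eval_X] at this
  rw [← this]
  ring

/-- Superconvergence at the right endpoint, by testing the weak form with an approximate solution
of the linearized adjoint equation. -/
theorem endpoint_error_isBigO {q : ℕ} {s ω : Fin (q + 1 + 1) → ℝ} {ℓ : Fin (q + 1 + 1) → ℝ[X]}
    {L : Matrix (Fin (q + 1 + 1)) (Fin (q + 1 + 1)) ℝ} {f : ℝ → ℝ → ℝ} {u : ℝ → ℝ} {tn : ℝ}
    {Y : ℝ → Fin (q + 1 + 1) → ℝ} {r : ℕ}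
    (hs : StrictMono s) (hs1 : ∀ j, s j ∈ Set.Icc (-1 : ℝ) 1) (hsp : s (Fin.last (q + 1)) = 1)
    (hexact : ∀ q' : ℝ[X], q'.natDegree ≤ 2 * (q + 1) →
      ∑ i, ω i * q'.eval (s i) = ∫ x in (-1:ℝ)..1, q'.eval x)
    (hdeg : ∀ i, (ℓ i).natDegree ≤ q + 1)
    (hval : ∀ i j, (ℓ i).eval (s j) = if i = j then 1 else 0)
    (hL : ∀ i j, L i j = ω j * (derivative (ℓ i)).eval (s j)
      - (if i = Fin.last (q + 1) then (1:ℝ) else 0) * (if j = Fin.last (q + 1) then (1:ℝ) else 0))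
    (hLinv : IsUnit L.det)
    (hf : ContDiff ℝ (2 * (q + 1) + 1 : ℕ) (Function.uncurry f))
    (hu : ∀ t, HasDerivAt u (f t (u t)) t)
    (hres : ∀ m, (fun h => Y h m - u tn
      - h / 2 * ∑ j, -(L⁻¹ m j) * ω j * f (tn + h / 2 * (s j + 1)) (Y h j))
        =O[𝓝[>] 0] fun h => h ^ r)
    (herr : ∀ m, (fun h => Y h m - u (tn + h / 2 * (s m + 1))) =O[𝓝[>] 0] fun h => h ^ (q + 1 + 2)) :
    (fun h => Y h (Fin.last (q + 1)) - u (tn + h / 2 * (1 + 1)))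
      =O[𝓝[>] 0] fun h => h ^ (min (2 * (q + 1) + 2) r) := by
  set a : ℝ → ℝ := fun t => fderiv ℝ (Function.uncurry f) (t, u t) (0, 1) with ha
  obtain ⟨huc, hg⟩ := contDiff_of_ode hf hu
  have hac : ContDiff ℝ (q + 1) a := by
    refine ((hf.fderiv_right (m := q + 1) (by norm_cast; omega)).comp
      (contDiff_id.prodMk (huc.of_le (by norm_cast; omega)))).clm_apply contDiff_const
  obtain ⟨V, hV, hV0, hadj⟩ := exists_polynomial_adjoint_approx hac tn
  have hVx : ∀ j, (fun h : ℝ => V.eval (h / 2 * (s j + 1))) =O[𝓝[>] 0] fun h => h ^ 0 :=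
    fun j => isBigO_one_comp_scaled_offset V.continuous _
  have hquad : (fun h => h / 2 * ∑ j, ω j * ((derivative V).eval (h / 2 * (s j + 1))
        * u (tn + h / 2 * (s j + 1))
        + V.eval (h / 2 * (s j + 1)) * f (tn + h / 2 * (s j + 1)) (u (tn + h / 2 * (s j + 1))))
      - (V.eval (h / 2 * (1 + 1)) * u (tn + h / 2 * (1 + 1)) - u tn))
      =O[𝓝[>] 0] fun h => h ^ (2 * (q + 1) + 2) := by
    have hφ : ∀ t, HasDerivAt (fun t => V.eval (t - tn) * u t)
        ((derivative V).eval (t - tn) * u t + V.eval (t - tn) * f t (u t)) t := fun t =>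
      HasDerivAt.mul ((V.hasDerivAt (t - tn)).comp_sub_const t tn) (hu t)
    have hpoly : ∀ W : ℝ[X], ContDiff ℝ (2 * (q + 1) + 1 : ℕ) fun t : ℝ => W.eval (t - tn) :=
      fun W => by
        have hW : ContDiff ℝ (2 * (q + 1) + 1 : ℕ) fun x => W.eval x := by
          simpa using W.contDiff_aeval (n := (2 * (q + 1) + 1 : ℕ)) (𝕜 := ℝ)
        exact hW.comp (contDiff_id.sub contDiff_const)
    have := quadrature_isBigO hs1 (σ := 1) (by norm_num) hexact hφ
      (((hpoly _).mul huc).add ((hpoly _).mul hg)) tn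
    simpa [hV0] using this
  have hRes : (fun h => ∑ j, (ω j * (h / 2 * (derivative V).eval (h / 2 * (s j + 1)))
      - if j = Fin.last (q + 1) then V.eval (h / 2 * (1 + 1)) else 0) * (Y h j - u tn
      - h / 2 * ∑ i, -(L⁻¹ j i) * ω i * f (tn + h / 2 * (s i + 1)) (Y h i)))
      =O[𝓝[>] 0] fun h => h ^ r := by
    refine IsBigO.fun_sum fun j _ => isBigO_mul_pow (m := 0) (IsBigO.sub ?_ ?_) (hres j) (by omega)
    · exact (((isBigO_half_mul (isBigO_one_comp_scaled_offset (derivative V).continuous _)).trans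
        (pow_isBigO_pow (Nat.zero_le _))).const_mul_left _)
    · split_ifs
      · exact isBigO_one_comp_scaled_offset V.continuous 1
      · exact isBigO_zero _ _
  have hlin : ∀ j, (fun h => f (tn + h / 2 * (s j + 1)) (Y h j)
      - f (tn + h / 2 * (s j + 1)) (u (tn + h / 2 * (s j + 1)))
      - a (tn + h / 2 * (s j + 1)) * (Y h j - u (tn + h / 2 * (s j + 1))))
      =O[𝓝[>] 0] fun h => h ^ (2 * (q + 1) + 2) := by
    intro j
    have ht : Tendsto (fun h : ℝ => tn + h / 2 * (s j + 1)) (𝓝[>] 0) (𝓝 tn) := by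
      simpa using (tendsto_scaled_offset (s j)).const_add tn
    have hut := ((hu tn).continuousAt.tendsto).comp ht
    have h0 : Tendsto (fun h : ℝ => h ^ (q + 1 + 2)) (𝓝[>] 0) (𝓝 0) := by
      have : Continuous fun h : ℝ => h ^ (q + 1 + 2) := by fun_prop
      simpa using (this.tendsto 0).mono_left nhdsWithin_le_nhds
    have hyt : Tendsto (fun h => Y h j) (𝓝[>] 0) (𝓝 (u tn)) := by
      simpa using ((herr j).trans_tendsto h0).add hut
    refine (isBigO_taylor_linearization (hf.of_le (by norm_cast; omega)) ht hyt hut).trans ?_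
    refine ((herr j).pow 2).trans ?_
    simp only [← pow_mul]
    exact pow_isBigO_pow (by omega)
  have hmain : (fun h => h / 2 * ∑ j, ω j * (((derivative V).eval (h / 2 * (s j + 1))
        + a (tn + h / 2 * (s j + 1)) * V.eval (h / 2 * (s j + 1)))
        * (Y h j - u (tn + h / 2 * (s j + 1)))
      + V.eval (h / 2 * (s j + 1)) * (f (tn + h / 2 * (s j + 1)) (Y h j)
        - f (tn + h / 2 * (s j + 1)) (u (tn + h / 2 * (s j + 1)))
        - a (tn + h / 2 * (s j + 1)) * (Y h j - u (tn + h / 2 * (s j + 1))))))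
      =O[𝓝[>] 0] fun h => h ^ (2 * (q + 1) + 2 + 1) :=
    isBigO_half_mul (IsBigO.fun_sum fun j _ => IsBigO.const_mul_left
      ((isBigO_mul_pow (hadj _ (hs1 j)) (herr j) (by omega)).add
        (isBigO_mul_pow (hVx j) (hlin j) (by omega))) _)
  have hprod : (fun h => V.eval (h / 2 * (1 + 1))
      * (Y h (Fin.last (q + 1)) - u (tn + h / 2 * (1 + 1))))
      =O[𝓝[>] 0] fun h => h ^ (min (2 * (q + 1) + 2) r) := by
    refine (((hmain.trans (pow_isBigO_pow (by omega))).add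
      (hquad.trans (pow_isBigO_pow (min_le_left _ _)))).sub
      (hRes.trans (pow_isBigO_pow (min_le_right _ _)))).congr_left fun h => ?_
    have hw := weak_form_residual hs hsp hexact hdeg hval hL hLinv
      (v := V.comp (C (h / 2) * (X + 1))) (natDegree_comp_le.trans (by
        have h1 : (C (h / 2) * (X + 1) : ℝ[X]).natDegree ≤ 1 := by compute_degree
        nlinarith)) (h / 2) (u tn) (Y h) fun j => f (tn + h / 2 * (s j + 1)) (Y h j)
    simp only [derivative_comp, eval_comp, eval_mul, eval_C, eval_add, eval_X, eval_one,
      derivative_mul, derivative_C, zero_mul, derivative_add, derivative_X, derivative_one,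
      add_zero, zero_add, mul_one, neg_add_cancel, mul_zero, hV0, one_mul] at hw
    rw [← hw, Finset.mul_sum, Finset.mul_sum, Finset.mul_sum]
    have hsum : ∀ (F₁ F₂ F₃ F₄ : Fin (q + 1 + 1) → ℝ) (_ : ∀ j, F₁ j + F₂ j - F₃ j - F₄ j = 0),
        ∑ j, F₁ j + ∑ j, F₂ j - ∑ j, F₃ j - ∑ j, F₄ j = 0 := fun F₁ F₂ F₃ F₄ hF => by
      simp only [← Finset.sum_add_distrib, ← Finset.sum_sub_distrib]
      exact Finset.sum_eq_zero fun j _ => hF j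
    refine sub_eq_zero.mp (Eq.trans ?_ (hsum
      (fun j => h / 2 * (ω j * (((derivative V).eval (h / 2 * (s j + 1))
        + a (tn + h / 2 * (s j + 1)) * V.eval (h / 2 * (s j + 1)))
        * (Y h j - u (tn + h / 2 * (s j + 1)))
        + V.eval (h / 2 * (s j + 1)) * (f (tn + h / 2 * (s j + 1)) (Y h j)
        - f (tn + h / 2 * (s j + 1)) (u (tn + h / 2 * (s j + 1)))
        - a (tn + h / 2 * (s j + 1)) * (Y h j - u (tn + h / 2 * (s j + 1)))))))
      (fun j => h / 2 * (ω j * ((derivative V).eval (h / 2 * (s j + 1))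
        * u (tn + h / 2 * (s j + 1))
        + V.eval (h / 2 * (s j + 1)) * f (tn + h / 2 * (s j + 1)) (u (tn + h / 2 * (s j + 1))))))
      (fun j => ω j * (h / 2 * (derivative V).eval (h / 2 * (s j + 1))) * Y h j)
      (fun j => h / 2 * (ω j * V.eval (h / 2 * (s j + 1))
        * f (tn + h / 2 * (s j + 1)) (Y h j))) fun j => ?_))
    · ring
    · ring
  have hVt : Tendsto (fun h : ℝ => V.eval (h / 2 * (1 + 1))) (𝓝[>] 0) (𝓝 1) := by
    simpa [hV0, Function.comp_def] using (V.continuous.tendsto 0).comp (tendsto_scaled_offset 1)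
  have hinv : (fun h : ℝ => (V.eval (h / 2 * (1 + 1)))⁻¹) =O[𝓝[>] 0] fun h => h ^ 0 := by
    simpa using (hVt.inv₀ one_ne_zero).isBigO_one ℝ
  refine (isBigO_mul_pow hinv hprod (zero_add _).ge).congr' ?_ EventuallyEq.rfl
  filter_upwards [hVt.eventually_ne one_ne_zero] with h hh
  exact inv_mul_cancel_left₀ hh _

/-- Local truncation error of the explicit SDG scheme. With the matrix `L̃`
built from the rows of `L⁻¹` (`L̃_{0,j} = -l⁻¹_{0,j}`, `L̃_{m+1,j} = l⁻¹_{m,j} - l⁻¹_{m+1,j}`),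
explicit Euler initialization and the explicit SDG update, for each fixed `K` there are
`C > 0`, `h₀ > 0` such that for `0 < h ≤ h₀`:
`|u(t_{n,m}) - U^K_m| ≤ C h^{min(p+2, K+2)}` for `0 ≤ m ≤ p-1` and
`|u(t_n + h) - U^K_p| ≤ C h^{min(2p+2, K+2)}`. -/
theorem sdg_explicit_local_truncation_error (p : ℕ) (s ω : Fin (p + 1) → ℝ)
    (hs : StrictMono s) (hs0 : (-1 : ℝ) < s 0) (hsp : s (Fin.last p) = 1)
    (hω : ∀ i, 0 < ω i)
    (hexact : ∀ q : Polynomial ℝ, q.natDegree ≤ 2 * p →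
      ∑ i, ω i * q.eval (s i) = ∫ x in (-1:ℝ)..1, q.eval x)
    (ℓ : Fin (p + 1) → Polynomial ℝ)
    (hdeg : ∀ i, (ℓ i).natDegree ≤ p)
    (hval : ∀ i j, (ℓ i).eval (s j) = if i = j then 1 else 0)
    (L : Matrix (Fin (p + 1)) (Fin (p + 1)) ℝ)
    (hLdef : ∀ i j, L i j =
      (∫ x in (-1:ℝ)..1, (Polynomial.derivative (ℓ i)).eval x * (ℓ j).eval x)
        - (if i = Fin.last p then (1:ℝ) else 0) * (if j = Fin.last p then (1:ℝ) else 0))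
    (hLinv : IsUnit L.det)
    (Ltil : Matrix (Fin (p + 1)) (Fin (p + 1)) ℝ)
    (hLtil0 : ∀ j, Ltil 0 j = -(L⁻¹ 0 j))
    (hLtilS : ∀ (m : Fin p) (j : Fin (p + 1)),
      Ltil m.succ j = L⁻¹ m.castSucc j - L⁻¹ m.succ j)
    (f : ℝ → ℝ → ℝ) (Λ : NNReal)
    (hf : ContDiff ℝ (2 * p + 1) (Function.uncurry f))
    (hLip : ∀ t, LipschitzWith Λ (f t))
    (u : ℝ → ℝ) (hu : ∀ t, HasDerivAt u (f t (u t)) t)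
    (tn un : ℝ) (hun : u tn = un)
    (U : ℝ → ℕ → Fin (p + 1) → ℝ)
    (hU0 : ∀ h m, U h 0 m = un + (h / 2 * (s m + 1)) * f tn un)
    (hUk0 : ∀ h k, U h (k + 1) 0
      = un + h / 2 * ∑ j, Ltil 0 j * ω j * f (tn + h / 2 * (s j + 1)) (U h k j))
    (hUkS : ∀ h k (m : Fin p), U h (k + 1) m.succ
      = U h (k + 1) m.castSucc
        + h / 2 * ω m.castSucc
          * (f (tn + h / 2 * (s m.castSucc + 1)) (U h (k + 1) m.castSucc)
            - f (tn + h / 2 * (s m.castSucc + 1)) (U h k m.castSucc))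
        + h / 2 * ∑ j, Ltil m.succ j * ω j * f (tn + h / 2 * (s j + 1)) (U h k j))
    (K : ℕ) :
    ∃ C > 0, ∃ h₀ > 0, ∀ h : ℝ, 0 < h → h ≤ h₀ →
      (∀ m : Fin (p + 1), (m : ℕ) < p →
        |u (tn + h / 2 * (s m + 1)) - U h K m| ≤ C * h ^ (min (p + 2) (K + 2))) ∧
      |u (tn + h) - U h K (Fin.last p)| ≤ C * h ^ (min (2 * p + 2) (K + 2)) := by
  have hs1 : ∀ j, s j ∈ Set.Icc (-1 : ℝ) 1 := fun j =>
    ⟨hs0.le.trans (hs.monotone (Fin.zero_le j)), hsp ▸ hs.monotone (Fin.le_last j)⟩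
  have hL := dgMatrix_eq hexact hdeg hval hLdef
  set A : Fin (p + 1) → Fin (p + 1) → ℝ := fun m j => -(L⁻¹ m j) * ω j
  have hAexact : ∀ m, ∀ q : Polynomial ℝ, q.natDegree ≤ p →
      ∑ j, A m j * q.eval (s j) = ∫ x in (-1 : ℝ)..s m, q.eval x :=
    fun m q hq => collocation_exact hsp hexact hdeg hval hL hLinv m hq
  have hA1 : ∀ m, ∑ j, A m j = s m + 1 := fun m => by
    simpa using hAexact m 1 (by simp)
  have hU : ∀ h k m, U h (k + 1) m = un
      + h / 2 * ∑ j, A m j * f (tn + h / 2 * (s j + 1)) (U h k j)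
      + h / 2 * ∑ i ∈ Finset.Iio m, ω i * (f (tn + h / 2 * (s i + 1)) (U h (k + 1) i)
        - f (tn + h / 2 * (s i + 1)) (U h k i)) := fun h k m =>
    sdg_update_eq hLtil0 hLtilS (F := fun j => f (tn + h / 2 * (s j + 1)) (U h k j))
      (G := fun j => f (tn + h / 2 * (s j + 1)) (U h (k + 1) j)) (hUk0 h k) (hUkS h k) m
  have hfn : ContDiff ℝ (2 * p + 1 : ℕ) (Function.uncurry f) := by exact_mod_cast hf
  have hg := (contDiff_of_ode hfn hu).2
  have hdiff := iterate_succ_sub_isBigO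
    (hfn.differentiable (by norm_cast)) hLip hA1 hU0 hU
  have heuler : ∀ m, (fun h => h / 2 * ((s m + 1) * f tn un) - (u (tn + h / 2 * (s m + 1)) - un))
      =O[𝓝[>] 0] fun h => h ^ 2 := fun m => by
    have := quadrature_isBigO (ι := Unit) (b := fun _ => s m + 1) (s := fun _ => -1) (N := 0)
      (by simp) (hs1 m) (fun q hq => by
        rw [eq_C_of_natDegree_le_zero hq]
        simp) hu (hg.of_le (by norm_cast; omega)) tn
    simpa [hun] using this
  have herr := iterate_error_isBigO hLip hU0 hU hdiff heuler fun m => by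
    have := quadrature_isBigO hs1 (hs1 m) (hAexact m) hu (hg.of_le (by norm_cast; omega)) tn
    rwa [hun] at this
  have hend : (fun h => U h K (Fin.last p) - u (tn + h / 2 * (1 + 1)))
      =O[𝓝[>] 0] fun h => h ^ (min (2 * p + 2) (K + 2)) := by
    by_cases hcase : min (2 * p + 2) (K + 2) ≤ min (p + 2) (K + 2)
    · have := (herr K (Fin.last p)).trans (pow_isBigO_pow hcase)
      rwa [hsp] at this
    · obtain ⟨q, rfl⟩ : ∃ q, p = q + 1 := ⟨p - 1, by omega⟩
      refine endpoint_error_isBigO hs hs1 hsp hexact hdeg hval hL hLinv hfn hu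
        (fun m => ?_) fun m => (herr K m).trans (pow_isBigO_pow (by omega))
      have := iterate_residual_isBigO hLip hU hdiff K m
      rwa [← hun] at this
  have hall : (fun h => ∑ m, |U h K m - u (tn + h / 2 * (s m + 1))|)
      =O[𝓝[>] 0] fun h => h ^ (min (p + 2) (K + 2)) :=
    IsBigO.fun_sum fun m _ => (herr K m).abs_left
  obtain ⟨C₁, hC₁, hb₁⟩ := hall.exists_pos
  obtain ⟨C₂, hC₂, hb₂⟩ := hend.exists_pos
  obtain ⟨h₀, hh₀, hsub⟩ := mem_nhdsGT_iff_exists_Ioc_subset.mp (hb₁.bound.and hb₂.bound)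
  refine ⟨max C₁ C₂, lt_max_of_lt_left hC₁, h₀, hh₀, fun h h0 h1 => ?_⟩
  obtain ⟨h₁, h₂⟩ := hsub ⟨h0, h1⟩
  rw [Real.norm_eq_abs, Real.norm_eq_abs, abs_of_pos (pow_pos h0 _)] at h₁ h₂
  refine ⟨fun m _ => ?_, ?_⟩
  · rw [abs_sub_comm]
    calc _ ≤ ∑ m, |U h K m - u (tn + h / 2 * (s m + 1))| :=
          Finset.single_le_sum (f := fun m => |U h K m - u (tn + h / 2 * (s m + 1))|)
            (fun _ _ => abs_nonneg _) (Finset.mem_univ m)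
      _ ≤ C₁ * h ^ (min (p + 2) (K + 2)) := (le_abs_self _).trans h₁
      _ ≤ _ := by gcongr; exact le_max_left _ _
  · rw [abs_sub_comm]
    rw [show h / 2 * (1 + 1) = h by ring] at h₂
    exact h₂.trans (by gcongr; exact le_max_right _ _)
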